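/- Let p ∈ [1,∞], ε ≥ 0, β ∈ ℝⁿ, let F₀ be a Borel probability distribution on ℝⁿ with finite p-th moment, and let ρ map Borel probability distributions on ℝ with finite p-th moment to ℝ. Then sup_{F ∈ B_p(F₀,ε)} ρ(pushforward of F under z ↦ β^⊤z) = sup_{G ∈ B_p(G₀, ε‖β‖_*)} ρ(G), where G₀ is the pushforward of F₀ under z ↦ β^⊤z and the ball on the right is a type-p Wasserstein ball of distributions on ℝ with the absolute-value norm. -/

import Mathlib

open MeasureTheory Set
open scoped ENNReal NNReal

noncomputable section

abbrev Vec (n : ℕ) := Fin n → ℝ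

/-- `β^⊤x` -/
def dotp {n : ℕ} (β x : Vec n) : ℝ := ∑ i, β i * x i

/-- `nrm` is a norm on `ℝⁿ`. -/
def IsNorm {n : ℕ} (nrm : Vec n → ℝ) : Prop :=
  (∀ x, nrm x = 0 ↔ x = 0) ∧
  (∀ (c : ℝ) (x : Vec n), nrm (c • x) = |c| * nrm x) ∧
  (∀ x y : Vec n, nrm (x + y) ≤ nrm x + nrm y)

/-- the dual norm `‖β‖_* = sup_{‖x‖ ≤ 1} β^⊤x`. -/
def dualNorm {n : ℕ} (nrm : Vec n → ℝ) (β : Vec n) : ℝ :=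
  sSup {r | ∃ x, nrm x ≤ 1 ∧ r = dotp β x}

/-- Couplings of two probability measures. -/
def Couplings {E : Type*} [MeasurableSpace E] (μ ν : Measure E) : Set (Measure (E × E)) :=
  {π | IsProbabilityMeasure π ∧ π.map Prod.fst = μ ∧ π.map Prod.snd = ν}

/-- The type-`p` Wasserstein distance (valued in `ℝ≥0∞`) associated with an
extended-real-valued cost; for `p = ∞` it is the infimum over couplings of the essential
supremum of the cost. -/
def WassersteinD {E : Type*} [MeasurableSpace E] (cost : E → E → ℝ≥0∞) (p : ℝ≥0∞)
    (μ ν : Measure E) : ℝ≥0∞ :=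
  if p = ∞ then ⨅ π ∈ Couplings μ ν, essSup (fun z : E × E => cost z.1 z.2) π
  else ⨅ π ∈ Couplings μ ν, (∫⁻ z, cost z.1 z.2 ^ p.toReal ∂π) ^ (1 / p.toReal)

/-- Finite `p`-th moment (with respect to a "norm-like" function `nrm`);
for `p = ∞` it means essential boundedness. -/
def HasMomentP {E : Type*} [MeasurableSpace E] (nrm : E → ℝ) (p : ℝ≥0∞) (μ : Measure E) : Prop :=
  if p = ∞ then essSup (fun x => ENNReal.ofReal (nrm x)) μ ≠ ∞
  else ∫⁻ x, ENNReal.ofReal (nrm x) ^ p.toReal ∂μ ≠ ∞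

/-- The type-`p` Wasserstein ball of probability distributions on `ℝⁿ` (norm `nrm`). -/
def WballVec {n : ℕ} (nrm : Vec n → ℝ) (p : ℝ≥0∞) (μ₀ : Measure (Vec n)) (ε : ℝ) :
    Set (Measure (Vec n)) :=
  {μ | IsProbabilityMeasure μ ∧ HasMomentP nrm p μ ∧
    WassersteinD (fun x y => ENNReal.ofReal (nrm (x - y))) p μ μ₀ ≤ ENNReal.ofReal ε}

/-- The type-`p` Wasserstein ball of probability distributions on `ℝ`
(absolute-value norm). -/
def WballReal (p : ℝ≥0∞) (μ₀ : Measure ℝ) (ε : ℝ) : Set (Measure ℝ) :=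
  {μ | IsProbabilityMeasure μ ∧ HasMomentP (fun x : ℝ => |x|) p μ ∧
    WassersteinD (fun x y : ℝ => ENNReal.ofReal |x - y|) p μ μ₀ ≤ ENNReal.ofReal ε}

/-- The metric on `Ξ = {-1,1} × ℝⁿ`:
`d((y₁,x₁),(y₂,x₂)) = ‖x₁ - x₂‖` if `y₁ = y₂`, and `+∞` otherwise. -/
def xiCost {n : ℕ} (nrm : Vec n → ℝ) (z₁ z₂ : ℝ × Vec n) : ℝ≥0∞ :=
  if z₁.1 = z₂.1 then ENNReal.ofReal (nrm (z₁.2 - z₂.2)) else ∞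

/-- A measure on `ℝ × ℝⁿ` is concentrated on `Ξ = {-1,1} × ℝⁿ`. -/
def OnXi {n : ℕ} (μ : Measure (ℝ × Vec n)) : Prop :=
  μ {z | z.1 = 1 ∨ z.1 = -1} = 1

/-- The type-`p` Wasserstein ball `B̄_p(F₀,ε)` of probability distributions on
`Ξ = {-1,1} × ℝⁿ`. -/
def WballXi {n : ℕ} (nrm : Vec n → ℝ) (p : ℝ≥0∞) (μ₀ : Measure (ℝ × Vec n)) (ε : ℝ) :
    Set (Measure (ℝ × Vec n)) :=
  {μ | IsProbabilityMeasure μ ∧ OnXi μ ∧ HasMomentP (fun z => nrm z.2) p μ ∧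
    WassersteinD (xiCost nrm) p μ μ₀ ≤ ENNReal.ofReal ε}

theorem isClosed_setOf_lintegral_le {X : Type*} [TopologicalSpace X] [MeasurableSpace X]
    [OpensMeasurableSpace X] {f : X → ℝ≥0} (hf : Continuous f) (a : ℝ≥0∞) :
    IsClosed {π : ProbabilityMeasure X | ∫⁻ x, f x ∂(π : Measure X) ≤ a} := by
  have key : {π : ProbabilityMeasure X | ∫⁻ x, f x ∂(π : Measure X) ≤ a} =
      ⋂ N : ℕ, {π : ProbabilityMeasure X |
        ∫⁻ x, ((min (f x) (N : ℝ≥0) : ℝ≥0) : ℝ≥0∞) ∂(π : Measure X) ≤ a} := by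
    ext π
    simp only [Set.mem_ofPred_eq, Set.mem_iInter]
    have hsup : ∀ x, (f x : ℝ≥0∞) = ⨆ N : ℕ, ((min (f x) (N : ℝ≥0) : ℝ≥0) : ℝ≥0∞) := by
      intro x
      refine le_antisymm ?_ (iSup_le fun N => by gcongr; exact min_le_left _ _)
      obtain ⟨N, hN⟩ := exists_nat_ge (f x)
      refine le_iSup_of_le N ?_
      rw [min_eq_left hN]
    simp_rw [hsup]
    rw [lintegral_iSup]
    · exact iSup_le_iff
    · intro N
      exact ((hf.min continuous_const).measurable).coe_nnreal_ennreal
    · intro N M hNM x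
      have : (N : ℝ≥0) ≤ M := by exact_mod_cast hNM
      dsimp only
      gcongr
  rw [key]
  refine isClosed_iInter fun N => ?_
  let g : BoundedContinuousFunction X ℝ≥0 :=
    BoundedContinuousFunction.mkOfBound ⟨fun x => min (f x) (N : ℝ≥0), hf.min continuous_const⟩
      (N : ℝ) (by
        intro x y
        rw [NNReal.dist_eq, abs_le]
        have h1 : ((min (f x) (N : ℝ≥0) : ℝ≥0) : ℝ) ≤ N := by
          exact_mod_cast min_le_right _ _
        have h2 : ((min (f y) (N : ℝ≥0) : ℝ≥0) : ℝ) ≤ N := by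
          exact_mod_cast min_le_right _ _
        have h3 := (min (f x) (N : ℝ≥0)).coe_nonneg
        have h4 := (min (f y) (N : ℝ≥0)).coe_nonneg
        simp only [ContinuousMap.coe_mk]
        constructor <;> linarith)
  exact isClosed_le
    (ProbabilityMeasure.continuous_lintegral_boundedContinuousFunction g) continuous_const

theorem isClosed_setOf_eLpNorm_le {X : Type*} [TopologicalSpace X] [MeasurableSpace X]
    [OpensMeasurableSpace X] {f : X → ℝ} (hf : Continuous f) (p : ℝ≥0∞) (a : ℝ≥0) :
    IsClosed {π : ProbabilityMeasure X | eLpNorm f p (π : Measure X) ≤ a} := by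
  rcases eq_or_ne p 0 with rfl | hp0
  · simp
  rcases eq_or_ne p ∞ with rfl | hp
  · have hg : Continuous fun x => ‖f x‖₊ - a := by fun_prop
    convert isClosed_setOf_lintegral_le hg 0 using 3 with π
    rw [nonpos_iff_eq_zero, lintegral_eq_zero_iff hg.measurable.coe_nnreal_ennreal,
      eLpNorm_exponent_top, eLpNormEssSup_eq_essSup_enorm]
    constructor
    · intro h
      filter_upwards [ENNReal.ae_le_essSup fun x => ‖f x‖ₑ] with x hx
      have : ‖f x‖₊ ≤ a := by exact_mod_cast hx.trans h
      simp [tsub_eq_zero_of_le this]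
    · intro h
      refine essSup_le_of_ae_le _ ?_
      filter_upwards [h] with x hx
      have h0 : ((‖f x‖₊ - a : ℝ≥0) : ℝ≥0∞) = 0 := hx
      have : ‖f x‖₊ ≤ a := tsub_eq_zero_iff_le.1 (by exact_mod_cast h0)
      exact_mod_cast this
  · have hp' : 0 < p.toReal := ENNReal.toReal_pos hp0 hp
    have hg : Continuous fun x => ‖f x‖₊ ^ p.toReal :=
      (NNReal.continuous_rpow_const hp'.le).comp hf.nnnorm
    convert isClosed_setOf_lintegral_le hg ((a : ℝ≥0∞) ^ p.toReal) using 3 with π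
    rw [eLpNorm_eq_lintegral_rpow_enorm_toReal hp0 hp, one_div, ENNReal.rpow_inv_le_iff hp']
    simp only [enorm_eq_nnnorm, ← ENNReal.coe_rpow_of_nonneg _ hp'.le]

theorem isCompact_setOf_mem_couplings {E : Type*} [MetricSpace E] [CompleteSpace E]
    [SecondCountableTopology E] [MeasurableSpace E] [BorelSpace E] (μ ν : Measure E)
    [IsProbabilityMeasure μ] [IsProbabilityMeasure ν] :
    IsCompact {π : ProbabilityMeasure (E × E) | (π : Measure (E × E)) ∈ Couplings μ ν} := by
  have hclosed :
      IsClosed {π : ProbabilityMeasure (E × E) | (π : Measure (E × E)) ∈ Couplings μ ν} := by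
    have h1 : IsClosed {π : ProbabilityMeasure (E × E) |
        π.map continuous_fst.measurable.aemeasurable = (⟨μ, inferInstance⟩ :
          ProbabilityMeasure E)} :=
      isClosed_eq (ProbabilityMeasure.continuous_map continuous_fst) continuous_const
    have h2 : IsClosed {π : ProbabilityMeasure (E × E) |
        π.map continuous_snd.measurable.aemeasurable = (⟨ν, inferInstance⟩ :
          ProbabilityMeasure E)} :=
      isClosed_eq (ProbabilityMeasure.continuous_map continuous_snd) continuous_const
    convert h1.inter h2 using 1
    ext π
    exact ⟨fun h => ⟨Subtype.ext h.2.1, Subtype.ext h.2.2⟩,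
      fun h => ⟨inferInstance, congrArg Subtype.val h.1, congrArg Subtype.val h.2⟩⟩
  rw [← hclosed.closure_eq]
  refine isCompact_closure_of_isTightMeasureSet (IsTightMeasureSet.prodMk ?_ ?_)
  · refine (isTightMeasureSet_singleton (μ := μ)).subset ?_
    rintro _ ⟨_, ⟨π, hπ, rfl⟩, rfl⟩
    exact hπ.2.1
  · refine (isTightMeasureSet_singleton (μ := ν)).subset ?_
    rintro _ ⟨_, ⟨π, hπ, rfl⟩, rfl⟩
    exact hπ.2.2

theorem wassersteinD_eq_iInf_eLpNorm {E : Type*} [MeasurableSpace E] {c : E → E → ℝ}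
    (hc : ∀ x y, 0 ≤ c x y) {p : ℝ≥0∞} (hp : p ≠ 0) (μ ν : Measure E) :
    WassersteinD (fun x y => ENNReal.ofReal (c x y)) p μ ν =
      ⨅ π ∈ Couplings μ ν, eLpNorm (fun z : E × E => c z.1 z.2) p π := by
  have h (x y) : ENNReal.ofReal (c x y) = ‖c x y‖ₑ := (Real.enorm_of_nonneg (hc x y)).symm
  simp only [WassersteinD, h]
  split_ifs with hp'
  · subst hp'
    simp only [eLpNorm_exponent_top, eLpNormEssSup_eq_essSup_enorm]
  · simp only [eLpNorm_eq_lintegral_rpow_enorm_toReal hp hp']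

theorem hasMomentP_iff_eLpNorm_ne_top {E : Type*} [MeasurableSpace E] {f : E → ℝ}
    (hf : ∀ x, 0 ≤ f x) {p : ℝ≥0∞} (hp : p ≠ 0) (μ : Measure E) :
    HasMomentP f p μ ↔ eLpNorm f p μ ≠ ∞ := by
  have h (x) : ENNReal.ofReal (f x) = ‖f x‖ₑ := (Real.enorm_of_nonneg (hf x)).symm
  simp only [HasMomentP, h]
  split_ifs with hp'
  · subst hp'
    simp only [eLpNorm_exponent_top, eLpNormEssSup_eq_essSup_enorm]
  · have := ENNReal.toReal_pos hp hp'
    rw [eLpNorm_eq_lintegral_rpow_enorm_toReal hp hp', one_div, Ne, Ne,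
      ENNReal.rpow_eq_top_iff_of_pos (inv_pos.2 this)]

theorem wassersteinD_le_iff_exists {E : Type*} [MetricSpace E] [CompleteSpace E]
    [SecondCountableTopology E] [MeasurableSpace E] [BorelSpace E] {c : E → E → ℝ}
    (hc : ∀ x y, 0 ≤ c x y) (hcont : Continuous fun z : E × E => c z.1 z.2)
    {p : ℝ≥0∞} (hp : p ≠ 0) (μ ν : Measure E)
    [IsProbabilityMeasure μ] [IsProbabilityMeasure ν] (a : ℝ≥0) :
    WassersteinD (fun x y => ENNReal.ofReal (c x y)) p μ ν ≤ a ↔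
      ∃ π ∈ Couplings μ ν, eLpNorm (fun z : E × E => c z.1 z.2) p π ≤ a := by
  rw [wassersteinD_eq_iInf_eLpNorm hc hp]
  refine ⟨fun h => ?_, fun ⟨π, hπ, h⟩ => (iInf₂_le π hπ).trans h⟩
  let u : ℕ → ℝ≥0 := fun n => 1 / ((n : ℝ≥0) + 1)
  have hu : Antitone u := fun n m hnm => by
    have : (n : ℝ≥0) ≤ m := by exact_mod_cast hnm
    dsimp only [u]
    gcongr
  let K := {π : ProbabilityMeasure (E × E) | (π : Measure (E × E)) ∈ Couplings μ ν}
  have hK : IsCompact K := isCompact_setOf_mem_couplings μ ν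
  let t : ℕ → Set (ProbabilityMeasure (E × E)) := fun n =>
    K ∩ {π | eLpNorm (fun z : E × E => c z.1 z.2) p (π : Measure (E × E)) ≤ (a + u n : ℝ≥0)}
  obtain ⟨π, hπ⟩ : (⋂ n, t n).Nonempty := by
    refine IsCompact.nonempty_iInter_of_sequence_nonempty_isCompact_isClosed t ?_ ?_ ?_ ?_
    · rintro n π ⟨h1, h2⟩
      have := hu n.le_succ
      simp only [Set.mem_ofPred_eq] at h2
      exact ⟨h1, h2.trans (by gcongr)⟩
    · intro n
      have hpos : 0 < u n := by positivity
      have : ⨅ π ∈ Couplings μ ν, eLpNorm (fun z : E × E => c z.1 z.2) p π <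
          (a + u n : ℝ≥0) :=
        h.trans_lt (by exact_mod_cast lt_add_of_pos_right a hpos)
      simp only [iInf_lt_iff] at this
      obtain ⟨π, hπ, hlt⟩ := this
      exact ⟨⟨π, hπ.1⟩, hπ, hlt.le⟩
    · exact hK.inter_right (isClosed_setOf_eLpNorm_le hcont p _)
    · exact fun n => hK.isClosed.inter (isClosed_setOf_eLpNorm_le hcont p _)
  simp only [Set.mem_iInter] at hπ
  refine ⟨π, (hπ 0).1, ?_⟩
  have hlim : Filter.Tendsto (fun n => ((a + u n : ℝ≥0) : ℝ≥0∞)) Filter.atTop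
      (nhds ((a + 0 : ℝ≥0) : ℝ≥0∞)) :=
    ENNReal.tendsto_coe.2 (tendsto_const_nhds.add tendsto_one_div_add_atTop_nhds_zero_nat)
  rw [add_zero] at hlim
  exact ge_of_tendsto' hlim fun n => (hπ n).2

theorem IsNorm.nonneg {n : ℕ} {nrm : Vec n → ℝ} (h : IsNorm nrm) (x : Vec n) : 0 ≤ nrm x := by
  have h0 : nrm 0 = 0 := (h.1 0).2 rfl
  have h1 : nrm (-x) = nrm x := by simpa using h.2.1 (-1) x
  have h2 := h.2.2 x (-x)
  rw [add_neg_cancel, h0, h1] at h2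
  linarith

theorem IsNorm.exists_le_mul_norm {n : ℕ} {nrm : Vec n → ℝ} (h : IsNorm nrm) :
    ∃ C : ℝ≥0, ∀ x, nrm x ≤ C * ‖x‖ := by
  refine ⟨⟨∑ i, nrm (Pi.single i 1), Finset.sum_nonneg fun i _ => h.nonneg _⟩, fun x => ?_⟩
  have hx : x = ∑ i, x i • (Pi.single i 1 : Vec n) := by
    ext j
    simp [Finset.sum_apply, Pi.single_apply]
  calc nrm x = nrm (∑ i, x i • (Pi.single i 1 : Vec n)) := by rw [← hx]
    _ ≤ ∑ i, nrm (x i • (Pi.single i 1 : Vec n)) :=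
        Finset.le_sum_of_subadditive nrm ((h.1 0).2 rfl).le h.2.2 _ _
    _ ≤ ∑ i, nrm (Pi.single i 1) * ‖x‖ := by
        refine Finset.sum_le_sum fun i _ => ?_
        rw [h.2.1, mul_comm]
        exact mul_le_mul_of_nonneg_left (norm_le_pi_norm x i) (h.nonneg _)
    _ = _ := by rw [← Finset.sum_mul]; rfl

theorem IsNorm.continuous {n : ℕ} {nrm : Vec n → ℝ} (h : IsNorm nrm) : Continuous nrm := by
  obtain ⟨C, hC⟩ := h.exists_le_mul_norm
  refine (LipschitzWith.of_le_add_mul C fun x y => ?_).continuous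
  have h1 := h.2.2 y (x - y)
  rw [add_sub_cancel] at h1
  rw [dist_eq_norm]
  linarith [hC (x - y)]

theorem IsNorm.isCompact_setOf_le_one {n : ℕ} {nrm : Vec n → ℝ} (h : IsNorm nrm) :
    IsCompact {x | nrm x ≤ 1} := by
  refine Metric.isCompact_of_isClosed_isBounded (isClosed_le h.continuous continuous_const) ?_
  obtain ⟨m, hm, hmle⟩ := (isCompact_sphere (0 : Vec n) 1).exists_forall_le'
    h.continuous.continuousOn (a := 0) (fun x hx => by
      refine lt_of_le_of_ne (h.nonneg x) fun h0 => ?_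
      rw [(h.1 x).1 h0.symm] at hx
      simp at hx)
  refine (Metric.isBounded_closedBall (x := (0 : Vec n)) (r := 1 / m)).subset fun x hx => ?_
  have hx : nrm x ≤ 1 := hx
  rw [mem_closedBall_zero_iff, le_div_iff₀ hm]
  rcases eq_or_ne x 0 with rfl | hx0
  · simp
  have hxn : 0 < ‖x‖ := norm_pos_iff.2 hx0
  have h1 := hmle (‖x‖⁻¹ • x) (by simp [norm_smul, hxn.ne'])
  rw [h.2.1, abs_of_pos (inv_pos.2 hxn), le_inv_mul_iff₀ hxn] at h1
  linarith

theorem continuous_dotp {n : ℕ} (β : Vec n) : Continuous fun x : Vec n => dotp β x := by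
  unfold dotp
  fun_prop

theorem dotp_add {n : ℕ} (β x y : Vec n) : dotp β (x + y) = dotp β x + dotp β y := by
  simp [dotp, mul_add, Finset.sum_add_distrib]

theorem dotp_smul {n : ℕ} (β : Vec n) (c : ℝ) (x : Vec n) :
    dotp β (c • x) = c * dotp β x := by
  simp only [dotp, Finset.mul_sum, Pi.smul_apply, smul_eq_mul]
  exact Finset.sum_congr rfl fun i _ => by ring

theorem dotp_sub {n : ℕ} (β x y : Vec n) : dotp β (x - y) = dotp β x - dotp β y := by
  simp [dotp, mul_sub, Finset.sum_sub_distrib]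

theorem IsNorm.exists_isGreatest_dualNorm {n : ℕ} {nrm : Vec n → ℝ} (h : IsNorm nrm)
    (β : Vec n) :
    ∃ v, nrm v ≤ 1 ∧ dotp β v = dualNorm nrm β ∧
      ∀ x, nrm x ≤ 1 → dotp β x ≤ dualNorm nrm β := by
  obtain ⟨v, hv, hmax⟩ := h.isCompact_setOf_le_one.exists_isMaxOn
    ⟨0, show nrm 0 ≤ 1 by rw [(h.1 0).2 rfl]; exact zero_le_one⟩ (continuous_dotp β).continuousOn
  have hmax' : ∀ x, nrm x ≤ 1 → dotp β x ≤ dotp β v := fun x hx => hmax hx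
  have hD : dualNorm nrm β = dotp β v := by
    refine IsGreatest.csSup_eq ⟨⟨v, hv, rfl⟩, ?_⟩
    rintro _ ⟨x, hx, rfl⟩
    exact hmax' x hx
  exact ⟨v, hv, hD.symm, fun x hx => hD ▸ hmax' x hx⟩

theorem IsNorm.dualNorm_nonneg {n : ℕ} {nrm : Vec n → ℝ} (h : IsNorm nrm) (β : Vec n) :
    0 ≤ dualNorm nrm β := by
  obtain ⟨-, -, -, hle⟩ := h.exists_isGreatest_dualNorm β
  simpa [dotp] using hle 0 (by rw [(h.1 0).2 rfl]; exact zero_le_one)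

theorem IsNorm.abs_dotp_le {n : ℕ} {nrm : Vec n → ℝ} (h : IsNorm nrm) (β x : Vec n) :
    |dotp β x| ≤ dualNorm nrm β * nrm x := by
  obtain ⟨-, -, -, hle⟩ := h.exists_isGreatest_dualNorm β
  rcases eq_or_ne x 0 with rfl | hx
  · simp [dotp, (h.1 0).2 rfl]
  have hpos : 0 < nrm x := lt_of_le_of_ne (h.nonneg x) fun h0 => hx ((h.1 x).1 h0.symm)
  have key : ∀ s : ℝ, |s| = 1 → s * dotp β x ≤ dualNorm nrm β * nrm x := by
    intro s hs
    have h1 := hle ((s * (nrm x)⁻¹) • x) (by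
      rw [h.2.1, abs_mul, hs, one_mul, abs_of_pos (inv_pos.2 hpos), inv_mul_cancel₀ hpos.ne'])
    rw [dotp_smul, mul_right_comm, ← div_eq_mul_inv, div_le_iff₀ hpos] at h1
    exact h1
  rw [abs_le]
  constructor
  · linarith [key (-1) (by simp)]
  · linarith [key 1 (by simp)]

open scoped ProbabilityTheory in
theorem exists_measure_prod_of_map_snd_eq {X : Type*} [MeasurableSpace X] {μ : Measure X}
    [IsProbabilityMeasure μ] {b : X → ℝ} (hb : Measurable b) {π : Measure (ℝ × ℝ)}
    [IsProbabilityMeasure π] (h : π.map Prod.snd = μ.map b) :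
    ∃ η : Measure (X × ℝ), IsProbabilityMeasure η ∧ η.map Prod.fst = μ ∧
      η.map (fun q => (q.2, b q.1)) = π := by
  let π' := π.map Prod.swap
  have : IsProbabilityMeasure π' := Measure.isProbabilityMeasure_map (by fun_prop)
  have hfst : π'.fst = μ.map b := by
    rw [← h, Measure.fst, Measure.map_map (by fun_prop) (by fun_prop)]
    rfl
  let κ := π'.condKernel
  refine ⟨μ ⊗ₘ (κ.comap b hb), inferInstance, Measure.fst_compProd _ _, ?_⟩
  have key : (μ ⊗ₘ (κ.comap b hb)).map (Prod.map b id) = π' := by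
    conv_rhs => rw [← π'.disintegrate π'.condKernel, hfst]
    ext s hs
    have : IsProbabilityMeasure (μ.map b) := Measure.isProbabilityMeasure_map (by fun_prop)
    rw [Measure.map_apply (by fun_prop) hs,
      Measure.compProd_apply (hs.preimage (by fun_prop)), Measure.compProd_apply hs,
      lintegral_map (ProbabilityTheory.Kernel.measurable_kernel_prodMk_left hs) hb]
    rfl
  have hswap : π'.map Prod.swap = π := by
    rw [Measure.map_map (by fun_prop) (by fun_prop)]
    simp
  rw [← hswap, ← key, Measure.map_map (by fun_prop) (by fun_prop)]
  rfl

theorem map_dotp_mem_WballReal {n : ℕ} {nrm : Vec n → ℝ} (hnrm : IsNorm nrm)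
    {p : ℝ≥0∞} (hp : p ≠ 0) {ε : ℝ} (β : Vec n) {F₀ F : Measure (Vec n)}
    [IsProbabilityMeasure F₀] (hF : F ∈ WballVec nrm p F₀ ε) :
    F.map (fun x => dotp β x) ∈
      WballReal p (F₀.map (fun x => dotp β x)) (ε * dualNorm nrm β) := by
  obtain ⟨hFp, hFm, hFW⟩ := hF
  have hb : Measurable fun x : Vec n => dotp β x := (continuous_dotp β).measurable
  have hcont := hnrm.continuous
  have hD := hnrm.dualNorm_nonneg β
  have hFG : IsProbabilityMeasure (F.map fun x => dotp β x) :=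
    Measure.isProbabilityMeasure_map hb.aemeasurable
  have hG₀ : IsProbabilityMeasure (F₀.map fun x => dotp β x) :=
    Measure.isProbabilityMeasure_map hb.aemeasurable
  refine ⟨hFG, ?_, ?_⟩
  · rw [hasMomentP_iff_eLpNorm_ne_top abs_nonneg hp]
    rw [hasMomentP_iff_eLpNorm_ne_top hnrm.nonneg hp] at hFm
    rw [eLpNorm_map_measure continuous_abs.aestronglyMeasurable hb.aemeasurable]
    refine ne_top_of_le_ne_top (ENNReal.mul_ne_top ENNReal.ofReal_ne_top hFm)
      (eLpNorm_le_mul_eLpNorm_of_ae_le_mul (c := dualNorm nrm β) (ae_of_all _ fun x => ?_) p)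
    simpa [abs_of_nonneg (hnrm.nonneg x)] using hnrm.abs_dotp_le β x
  · obtain ⟨π, ⟨hπ, hπ₁, hπ₂⟩, hle⟩ := (wassersteinD_le_iff_exists
      (c := fun x y => nrm (x - y)) (fun x y => hnrm.nonneg _) (by fun_prop) hp F F₀ _).1 hFW
    refine (wassersteinD_le_iff_exists (c := fun x y : ℝ => |x - y|)
      (fun x y => abs_nonneg _) (by fun_prop) hp _ _ _).2
      ⟨π.map (Prod.map (fun x => dotp β x) fun x => dotp β x), ⟨?_, ?_, ?_⟩, ?_⟩
    · exact Measure.isProbabilityMeasure_map (by fun_prop)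
    · rw [Measure.map_map (by fun_prop) (by fun_prop), ← hπ₁,
        Measure.map_map (by fun_prop) (by fun_prop)]
      rfl
    · rw [Measure.map_map (by fun_prop) (by fun_prop), ← hπ₂,
        Measure.map_map (by fun_prop) (by fun_prop)]
      rfl
    · rw [eLpNorm_map_measure (Continuous.aestronglyMeasurable (by fun_prop)) (by fun_prop)]
      refine (eLpNorm_le_mul_eLpNorm_of_ae_le_mul (c := dualNorm nrm β)
        (g := fun z : Vec n × Vec n => nrm (z.1 - z.2)) (ae_of_all _ fun z => ?_) p).trans ?_
      · simpa [abs_of_nonneg (hnrm.nonneg _), dotp_sub] using hnrm.abs_dotp_le β (z.1 - z.2)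
      · change _ ≤ ENNReal.ofReal (ε * dualNorm nrm β)
        rw [mul_comm ε, ENNReal.ofReal_mul hD]
        exact mul_le_mul_right hle _

theorem exists_map_dotp_eq_of_mem_WballReal {n : ℕ} {nrm : Vec n → ℝ} (hnrm : IsNorm nrm)
    {p : ℝ≥0∞} (hp : 1 ≤ p) {ε : ℝ} (hε : 0 ≤ ε) (β : Vec n) {F₀ : Measure (Vec n)}
    [IsProbabilityMeasure F₀] (hmom : HasMomentP nrm p F₀) {G : Measure ℝ}
    (hG : G ∈ WballReal p (F₀.map (fun x => dotp β x)) (ε * dualNorm nrm β)) :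
    ∃ F ∈ WballVec nrm p F₀ ε, F.map (fun x => dotp β x) = G := by
  obtain ⟨hGp, -, hGW⟩ := hG
  have hp0 : p ≠ 0 := (zero_lt_one.trans_le hp).ne'
  have hb : Measurable fun x : Vec n => dotp β x := (continuous_dotp β).measurable
  have hbc := continuous_dotp β
  have hcont := hnrm.continuous
  have hG₀ : IsProbabilityMeasure (F₀.map fun x => dotp β x) :=
    Measure.isProbabilityMeasure_map hb.aemeasurable
  obtain ⟨v, hv, hvD, -⟩ := hnrm.exists_isGreatest_dualNorm β
  have hD := hnrm.dualNorm_nonneg β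
  set D := dualNorm nrm β
  obtain ⟨π, ⟨hπ, hπ₁, hπ₂⟩, hle⟩ := (wassersteinD_le_iff_exists (c := fun x y : ℝ => |x - y|)
      (fun x y => abs_nonneg _) (by fun_prop) hp0 G _ _).1 hGW
  obtain ⟨η, hη, hη₁, hηπ⟩ := exists_measure_prod_of_map_snd_eq hb hπ₂
  have hηle : eLpNorm (fun q : Vec n × ℝ => |q.2 - dotp β q.1|) p η ≤
      ENNReal.ofReal (ε * D) := by
    rw [← hηπ, eLpNorm_map_measure (Continuous.aestronglyMeasurable (by fun_prop))
      (by fun_prop)] at hle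
    exact hle
  let T : Vec n × ℝ → Vec n := fun q => q.1 + ((q.2 - dotp β q.1) / D) • v
  have hT : Continuous T := by fun_prop
  have hTD : ∀ q, nrm (T q - q.1) ≤ D⁻¹ * |q.2 - dotp β q.1| := by
    intro q
    simp only [T, add_sub_cancel_left]
    rw [hnrm.2.1, abs_div, abs_of_nonneg hD, div_eq_inv_mul]
    exact mul_le_of_le_one_right (by positivity) hv
  have hTle : eLpNorm (fun q => nrm (T q - q.1)) p η ≤ ENNReal.ofReal ε := by
    refine (eLpNorm_le_mul_eLpNorm_of_ae_le_mul (c := D⁻¹)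
      (g := fun q : Vec n × ℝ => |q.2 - dotp β q.1|) (ae_of_all _ fun q => ?_) p).trans ?_
    · simpa [abs_of_nonneg (hnrm.nonneg _)] using hTD q
    · refine (mul_le_mul_right hηle _).trans ?_
      rw [← ENNReal.ofReal_mul (inv_nonneg.2 hD)]
      refine ENNReal.ofReal_le_ofReal ?_
      rw [mul_comm, mul_assoc]
      exact mul_le_of_le_one_right hε mul_inv_le_one
  have hTG : (fun q => dotp β (T q)) =ᵐ[η] Prod.snd := by
    rcases hD.eq_or_lt with h0 | hpos
    · rw [← h0, mul_zero, ENNReal.ofReal_zero, nonpos_iff_eq_zero,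
        eLpNorm_eq_zero_iff (Continuous.aestronglyMeasurable (by fun_prop)) hp0] at hηle
      filter_upwards [hηle] with q hq
      have : q.2 - dotp β q.1 = 0 := abs_eq_zero.1 hq
      simp only [T, this, zero_div, zero_smul, add_zero]
      linarith
    · refine ae_of_all _ fun q => ?_
      simp only [T]
      rw [dotp_add, dotp_smul, hvD, div_mul_cancel₀ _ hpos.ne', add_sub_cancel]
  refine ⟨η.map T, ⟨Measure.isProbabilityMeasure_map (by fun_prop), ?_, ?_⟩, ?_⟩
  · rw [hasMomentP_iff_eLpNorm_ne_top hnrm.nonneg hp0] at hmom ⊢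
    rw [← hη₁, eLpNorm_map_measure hcont.aestronglyMeasurable (by fun_prop)] at hmom
    rw [eLpNorm_map_measure hcont.aestronglyMeasurable (by fun_prop)]
    refine ne_top_of_le_ne_top (ENNReal.add_ne_top.2
      ⟨hmom, ne_top_of_le_ne_top ENNReal.ofReal_ne_top hTle⟩) (le_trans
        (eLpNorm_mono_real fun q => ?_) (eLpNorm_add_le
          (Continuous.aestronglyMeasurable (by fun_prop))
          (Continuous.aestronglyMeasurable (by fun_prop)) hp))
    have := hnrm.2.2 q.1 (T q - q.1)
    rw [add_sub_cancel] at this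
    simpa [abs_of_nonneg (hnrm.nonneg _)] using this
  · have : IsProbabilityMeasure (η.map T) := Measure.isProbabilityMeasure_map (by fun_prop)
    refine (wassersteinD_le_iff_exists (c := fun x y => nrm (x - y))
      (fun x y => hnrm.nonneg _) (by fun_prop) hp0 _ _ _).2
      ⟨η.map fun q => (T q, q.1), ⟨?_, ?_, ?_⟩, ?_⟩
    · exact Measure.isProbabilityMeasure_map (by fun_prop)
    · rw [Measure.map_map (by fun_prop) (by fun_prop)]
      rfl
    · rw [Measure.map_map (by fun_prop) (by fun_prop)]
      exact hη₁
    · rw [eLpNorm_map_measure (Continuous.aestronglyMeasurable (by fun_prop)) (by fun_prop)]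
      exact hTle
  · rw [Measure.map_map (by fun_prop) (by fun_prop), ← hπ₁, ← hηπ,
      Measure.map_map (by fun_prop) (by fun_prop)]
    exact Measure.map_congr hTG

/-- Lemma 2 of the paper: the worst case of a distributional functional `ρ`
over the projections of a type-`p` Wasserstein ball on `ℝⁿ` equals its worst case over the
one-dimensional type-`p` Wasserstein ball around the projected center, with radius `ε‖β‖_*`. -/
theorem stmt6 {n : ℕ} (nrm : Vec n → ℝ) (hnrm : IsNorm nrm)
    (p : ℝ≥0∞) (hp : 1 ≤ p) (ε : ℝ) (hε : 0 ≤ ε) (β : Vec n)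
    (F₀ : Measure (Vec n)) (hF₀ : IsProbabilityMeasure F₀) (hmom : HasMomentP nrm p F₀)
    (ρ : Measure ℝ → ℝ) :
    sSup ((fun F : Measure (Vec n) => ρ (F.map (fun x => dotp β x))) '' WballVec nrm p F₀ ε)
      = sSup (ρ '' WballReal p (F₀.map (fun x => dotp β x)) (ε * dualNorm nrm β)) := by
  congr 1
  ext r
  constructor
  · rintro ⟨F, hF, rfl⟩
    exact ⟨_, map_dotp_mem_WballReal hnrm (zero_lt_one.trans_le hp).ne' β hF, rfl⟩
  · rintro ⟨G, hG, rfl⟩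
    obtain ⟨F, hF, rfl⟩ := exists_map_dotp_eq_of_mem_WballReal hnrm hp hε β hmom hG
    exact ⟨F, hF, rfl⟩
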